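/- Let P = (P_1,…,P_k) be a hinge on ℂ^n, and for each j ∈ {1,…,n} let λ^j(P) be a choice of the (up to nonzero scalar unique) nonzero operator among λ^j(P_1),…,λ^j(P_k). Then the operator ⊗_{j=1}^n λ^j(P)^{⊗(ν_j−ν_{j+1})} on 𝔉_ν maps the subspace H_ν into itself. -/

import Mathlib

open Module

noncomputable section

variable {V W Y Z : Type*}
  [AddCommGroup V] [Module ℂ V] [AddCommGroup W] [Module ℂ W]
  [AddCommGroup Y] [Module ℂ Y] [AddCommGroup Z] [Module ℂ Z]

/-- The kernel of a linear relation `P : V ⇉ W`. -/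
def relKer (P : Submodule ℂ (V × W)) : Submodule ℂ V :=
  P.comap (LinearMap.inl ℂ V W)

/-- The indefiniteness of a linear relation `P : V ⇉ W`. -/
def relIndef (P : Submodule ℂ (V × W)) : Submodule ℂ W :=
  P.comap (LinearMap.inr ℂ V W)

/-- The domain of a linear relation `P : V ⇉ W`. -/
def relDom (P : Submodule ℂ (V × W)) : Submodule ℂ V :=
  P.map (LinearMap.fst ℂ V W)

/-- The image of a linear relation `P : V ⇉ W`. -/
def relIm (P : Submodule ℂ (V × W)) : Submodule ℂ W :=
  P.map (LinearMap.snd ℂ V W)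

/-- The product `QP` of two linear relations. -/
def relComp (Q : Submodule ℂ (W × Y)) (P : Submodule ℂ (V × W)) : Submodule ℂ (V × Y) where
  carrier := {p | ∃ w : W, (p.1, w) ∈ P ∧ (w, p.2) ∈ Q}
  add_mem' := by
    rintro ⟨a, b⟩ ⟨c, d⟩ ⟨w₁, h₁, h₂⟩ ⟨w₂, h₃, h₄⟩
    exact ⟨w₁ + w₂, P.add_mem h₁ h₃, Q.add_mem h₂ h₄⟩
  zero_mem' := ⟨0, P.zero_mem, Q.zero_mem⟩
  smul_mem' := by
    rintro c ⟨a, b⟩ ⟨w, h₁, h₂⟩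
    exact ⟨c • w, P.smul_mem c h₁, Q.smul_mem c h₂⟩

/-- The pair `(Q, P)` of linear relations is transversal. -/
def Transversal (Q : Submodule ℂ (W × Y)) (P : Submodule ℂ (V × W)) : Prop :=
  relIm P ⊔ relDom Q = ⊤ ∧ relIndef P ⊓ relKer Q = ⊥

end

noncomputable section

variable {V W : Type*} [AddCommGroup V] [Module ℂ V] [AddCommGroup W] [Module ℂ W]

/-- A canonical basis pair for a linear relation `S : V ⇉ W`: a basis
`f₁,…,f_α, g₁,…,g_β, h₁,…,h_γ` of `V` and a basis `F₁,…,F_μ, G₁,…,G_β, H₁,…,H_ν` of `W`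
such that `S` is spanned by the vectors `(0,Fᵢ)`, `(gⱼ,Gⱼ)`, `(hₗ,0)`. -/
structure CanonicalBasisPair (S : Submodule ℂ (V × W)) where
  α : ℕ
  β : ℕ
  γ : ℕ
  μ : ℕ
  ν : ℕ
  bV : Basis (Fin α ⊕ Fin β ⊕ Fin γ) ℂ V
  bW : Basis (Fin μ ⊕ Fin β ⊕ Fin ν) ℂ W
  hspan : S = Submodule.span ℂ
      (Set.range (fun i : Fin μ => ((0 : V), bW (Sum.inl i))) ∪
       Set.range (fun j : Fin β => (bV (Sum.inr (Sum.inl j)), bW (Sum.inr (Sum.inl j)))) ∪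
       Set.range (fun l : Fin γ => (bV (Sum.inr (Sum.inr l)), (0 : W))))

end

noncomputable section

variable {V W : Type*} [AddCommGroup V] [Module ℂ V] [AddCommGroup W] [Module ℂ W]

/-- The tuple `f₁, …, f_α, g_{i₁}, …, g_{i_s}` (with `i₁ < … < i_s` the elements of `s`)
in `V`, associated with a canonical basis pair. -/
def goodTupleV {S : Submodule ℂ (V × W)} (c : CanonicalBasisPair S)
    (s : Finset (Fin c.β)) : Fin (c.α + s.card) → V :=
  Fin.addCases (fun i => c.bV (Sum.inl i))
    (fun j => c.bV (Sum.inr (Sum.inl ((s.orderIsoOfFin rfl j : s) : Fin c.β))))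

/-- The tuple `F₁, …, F_μ, G_{i₁}, …, G_{i_s}` (with `i₁ < … < i_s` the elements of `s`)
in `W`, associated with a canonical basis pair. -/
def goodTupleW {S : Submodule ℂ (V × W)} (c : CanonicalBasisPair S)
    (s : Finset (Fin c.β)) : Fin (c.μ + s.card) → W :=
  Fin.addCases (fun i => c.bW (Sum.inl i))
    (fun j => c.bW (Sum.inr (Sum.inl ((s.orderIsoOfFin rfl j : s) : Fin c.β))))

/-- `L : Λ(V) → Λ(W)` is the operator `λ(S)` obtained from the canonical basis pair `c` for `S`:
it sends each basis monomial `f₁∧…∧f_α∧g_{i₁}∧…∧g_{i_s}` to `F₁∧…∧F_μ∧G_{i₁}∧…∧G_{i_s}` and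
every other monomial in the chosen basis of `V` (i.e. every monomial of basis vectors that
misses some `f` or contains some `h`) to `0`. -/
def IsLambda {S : Submodule ℂ (V × W)} (c : CanonicalBasisPair S)
    (L : ExteriorAlgebra ℂ V →ₗ[ℂ] ExteriorAlgebra ℂ W) : Prop :=
  (∀ s : Finset (Fin c.β),
      L (ExteriorAlgebra.ιMulti ℂ _ (goodTupleV c s)) =
        ExteriorAlgebra.ιMulti ℂ _ (goodTupleW c s)) ∧
  (∀ (k : ℕ) (x : Fin k → (Fin c.α ⊕ Fin c.β ⊕ Fin c.γ)),
      ((∃ i : Fin c.α, Sum.inl i ∉ Set.range x) ∨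
        (∃ l : Fin c.γ, Sum.inr (Sum.inr l) ∈ Set.range x)) →
      L (ExteriorAlgebra.ιMulti ℂ k (fun i => c.bV (x i))) = 0)

end

noncomputable section

variable {V W : Type*} [AddCommGroup V] [Module ℂ V] [AddCommGroup W] [Module ℂ W]

/-- The wedge product `x₁ ∧ … ∧ x_m` as an element of the `m`-th exterior power. -/
def ιMultiP (m : ℕ) (x : Fin m → V) : ⋀[ℂ]^m V :=
  ⟨ExteriorAlgebra.ιMulti ℂ m x, ExteriorAlgebra.ιMulti_range ℂ m (Set.mem_range_self x)⟩

/-- `L : Λ^m V → Λ^m W` is the degree-`m` component `λ^m(S)` of the operator obtained from the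
canonical basis pair `c` for `S`: it sends each degree-`m` basis monomial
`f₁∧…∧f_α∧g_{i₁}∧…∧g_{i_s}` to `F₁∧…∧F_μ∧G_{i₁}∧…∧G_{i_s}` and every other degree-`m`
monomial in the chosen basis of `V` to `0`. -/
def IsLambdaM {S : Submodule ℂ (V × W)} (c : CanonicalBasisPair S) (m : ℕ)
    (L : (⋀[ℂ]^m V) →ₗ[ℂ] (⋀[ℂ]^m W)) : Prop :=
  (∀ (s : Finset (Fin c.β)) (h1 : c.α + s.card = m) (h2 : c.μ + s.card = m),
      L (ιMultiP m (goodTupleV c s ∘ Fin.cast h1.symm)) =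
        ιMultiP m (goodTupleW c s ∘ Fin.cast h2.symm)) ∧
  (∀ x : Fin m → (Fin c.α ⊕ Fin c.β ⊕ Fin c.γ),
      ((∃ i : Fin c.α, Sum.inl i ∉ Set.range x) ∨
        (∃ l : Fin c.γ, Sum.inr (Sum.inr l) ∈ Set.range x)) →
      L (ιMultiP m fun i => c.bV (x i)) = 0)

end

/-- `(P 0, …, P (k-1))` is a hinge on `V` (with `n = dim V`): each `P j` is a linear relation
`V ⇉ V` of dimension `n`, consecutive terms satisfy `Ker P_j = Dom P_{j+1}` and
`Im P_j = Indef P_{j+1}`, the first term satisfies `Dom P_1 = V`, the last term satisfies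
`Im P_k = V`, and every term has positive rank. -/
structure IsHinge {V : Type*} [AddCommGroup V] [Module ℂ V]
    {k : ℕ} (P : Fin k → Submodule ℂ (V × V)) : Prop where
  pos : 0 < k
  dim_eq : ∀ j, Module.finrank ℂ (P j) = Module.finrank ℂ V
  ker_eq_dom : ∀ (j : ℕ) (h : j + 1 < k), relKer (P ⟨j, by omega⟩) = relDom (P ⟨j + 1, h⟩)
  im_eq_indef : ∀ (j : ℕ) (h : j + 1 < k), relIm (P ⟨j, by omega⟩) = relIndef (P ⟨j + 1, h⟩)
  dom_first : relDom (P ⟨0, pos⟩) = ⊤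
  im_last : relIm (P ⟨k - 1, by omega⟩) = ⊤
  rk_pos : ∀ j, Module.finrank ℂ (relKer (P j)) + Module.finrank ℂ (relIndef (P j)) <
    Module.finrank ℂ (P j)

noncomputable section

open scoped TensorProduct

/-- The `j`-th exterior power of a linear map, as a map between exterior powers. -/
def exteriorPowerMap {V W : Type*} [AddCommGroup V] [Module ℂ V] [AddCommGroup W] [Module ℂ W]
    (j : ℕ) (f : V →ₗ[ℂ] W) : (⋀[ℂ]^j V) →ₗ[ℂ] (⋀[ℂ]^j W) :=
  LinearMap.restrict (ExteriorAlgebra.map f).toLinearMap (by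
    intro x hx
    have h : Submodule.map (ExteriorAlgebra.map f).toLinearMap (⋀[ℂ]^j V) ≤ ⋀[ℂ]^j W := by
      rw [Submodule.map_pow]
      refine pow_le_pow_left' ?_ j
      rintro y ⟨z, ⟨v, rfl⟩, rfl⟩
      exact ⟨f v, (ExteriorAlgebra.map_apply_ι f v).symm⟩
    exact h ⟨x, hx, rfl⟩)

variable (n : ℕ) (ν : ℕ → ℕ)

/-- The representation space `𝔉_ν = ⨂_{j=1}^{n} (Λ^j ℂⁿ)^{⊗(ν_j − ν_{j+1})}`. -/
abbrev FrakF : Type :=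
  ⨂[ℂ] d : Fin n, (⨂[ℂ]^(ν (d.1 + 1) - ν (d.1 + 2)) ↥(⋀[ℂ]^(d.1 + 1) (Fin n → ℂ)))

/-- The vector `ξ_j = e₁ ∧ … ∧ e_j ∈ Λ^j ℂⁿ` (here `j = d + 1`). -/
def xiVec (d : Fin n) : ⋀[ℂ]^(d.1 + 1) (Fin n → ℂ) :=
  ιMultiP (d.1 + 1) (fun i => Pi.basisFun ℂ (Fin n) (Fin.castLE d.isLt i))

/-- The highest weight vector `Ξ_ν = ⨂_j ξ_j^{⊗(ν_j − ν_{j+1})} ∈ 𝔉_ν`. -/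
def XiNu : FrakF n ν :=
  PiTensorProduct.tprod ℂ (fun d => PiTensorProduct.tprod ℂ (fun _ => xiVec n d))

/-- The operator `⨂_{j=1}^{n} L_j^{⊗(ν_j − ν_{j+1})}` on `𝔉_ν` built from a family of operators
`L_j : Λ^j ℂⁿ → Λ^j ℂⁿ`. -/
def bigTensorOp
    (L : ∀ d : Fin n, (⋀[ℂ]^(d.1 + 1) (Fin n → ℂ)) →ₗ[ℂ] (⋀[ℂ]^(d.1 + 1) (Fin n → ℂ))) :
    FrakF n ν →ₗ[ℂ] FrakF n ν :=
  PiTensorProduct.map (fun d => PiTensorProduct.map (fun _ => L d))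

/-- The representation `𝔯_ν(g) = ⨂_{j=1}^{n} (Λ^j g)^{⊗(ν_j − ν_{j+1})}` of `GL_n(ℂ)`. -/
def rNu (g : (Fin n → ℂ) ≃ₗ[ℂ] (Fin n → ℂ)) : FrakF n ν →ₗ[ℂ] FrakF n ν :=
  bigTensorOp n ν (fun d => exteriorPowerMap (d.1 + 1) (g : (Fin n → ℂ) →ₗ[ℂ] (Fin n → ℂ)))

/-- `H_ν ⊆ 𝔉_ν`, the span of the `GL_n(ℂ)`-orbit of `Ξ_ν`. -/
def HNu : Submodule ℂ (FrakF n ν) :=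
  Submodule.span ℂ (Set.range fun g : (Fin n → ℂ) ≃ₗ[ℂ] (Fin n → ℂ) => rNu n ν g (XiNu n ν))

/-- `L` is a choice of the operator `λ^m(P)` of a hinge `P = (P_1,…,P_k)`: a nonzero operator
obtained from a canonical basis pair of one of the terms `P_i`. -/
def IsLambdaChoice {V : Type*} [AddCommGroup V] [Module ℂ V]
    {k : ℕ} (P : Fin k → Submodule ℂ (V × V)) (m : ℕ)
    (L : (⋀[ℂ]^m V) →ₗ[ℂ] (⋀[ℂ]^m V)) : Prop :=
  ∃ (i : Fin k) (c : CanonicalBasisPair (P i)), IsLambdaM c m L ∧ L ≠ 0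

end


section PolynomialFamilies

/-- A function `ℂ → E` into a complex vector space that is polynomial in its argument. -/
def IsPolyFamily {E : Type*} [AddCommMonoid E] [Module ℂ E] (f : ℂ → E) : Prop :=
  ∃ (κ : Type) (_ : Fintype κ) (a : κ → ℕ) (v : κ → E), ∀ s, f s = ∑ i, s ^ a i • v i

theorem IsPolyFamily.multilinear {ι : Type} [Fintype ι] {E : ι → Type*} {F : Type*}
    [∀ i, AddCommMonoid (E i)] [∀ i, Module ℂ (E i)] [AddCommMonoid F] [Module ℂ F]
    (m : MultilinearMap ℂ E F) {f : ∀ i, ℂ → E i} (hf : ∀ i, IsPolyFamily (f i)) :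
    IsPolyFamily (fun s => m (fun i => f i s)) := by
  classical
  choose κ hκ a v h using hf
  refine ⟨∀ i, κ i, inferInstance, fun r => ∑ i, a i (r i), fun r => m (fun i => v i (r i)),
    fun s => ?_⟩
  simp only [h]
  rw [MultilinearMap.map_sum]
  refine Finset.sum_congr rfl fun r _ => ?_
  rw [MultilinearMap.map_smul_univ, Finset.prod_pow_eq_pow_sum]

theorem IsPolyFamily.linear {E F : Type*} [AddCommMonoid E] [Module ℂ E] [AddCommMonoid F]
    [Module ℂ F] (l : E →ₗ[ℂ] F) {f : ℂ → E} (hf : IsPolyFamily f) :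
    IsPolyFamily (fun s => l (f s)) := by
  obtain ⟨κ, hκ, a, v, h⟩ := hf
  exact ⟨κ, hκ, a, fun i => l (v i), fun s => by simp [h]⟩

theorem IsPolyFamily.mem_of_forall_ne_zero {E : Type*} [AddCommGroup E] [Module ℂ E]
    {f : ℂ → E} (hf : IsPolyFamily f) (H : Submodule ℂ E) (h : ∀ s, s ≠ 0 → f s ∈ H) :
    f 0 ∈ H := by
  by_contra h0
  obtain ⟨φ, hφ, hH⟩ := Submodule.exists_le_ker_of_notMem h0
  obtain ⟨κ, hκ, a, v, hv⟩ := hf.linear φ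
  have hc : Continuous fun s => φ (f s) := by
    have : (fun s => φ (f s)) = fun s => ∑ i, s ^ a i • v i := funext hv
    rw [this]
    fun_prop
  have he : (fun s => φ (f s)) = fun _ => 0 :=
    hc.ext_on (dense_compl_singleton (0 : ℂ)) continuous_const fun s hs => hH (h s hs)
  exact hφ (congrFun he 0)

theorem IsPolyFamily.mem_submodule {E : Type*} [AddCommMonoid E] [Module ℂ E]
    {f : ℂ → E} (hf : IsPolyFamily f) (H : Submodule ℂ E) (h : ∀ s, s ≠ 0 → f s ∈ H) :
    f 0 ∈ H :=
  @IsPolyFamily.mem_of_forall_ne_zero E (Module.addCommMonoidToAddCommGroup ℂ) _ f hf H h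

theorem IsPolyFamily.piTensorProduct_map {ι : Type} [Fintype ι] {E : ι → Type*}
    [∀ i, AddCommMonoid (E i)] [∀ i, Module ℂ (E i)] {F : ∀ i, ℂ → (E i →ₗ[ℂ] E i)}
    (hF : ∀ i, IsPolyFamily (F i)) :
    IsPolyFamily (fun s => PiTensorProduct.map (fun i => F i s)) :=
  IsPolyFamily.multilinear (PiTensorProduct.mapMultilinear ℂ _ _) hF

theorem piTensorProduct_map_smul {ι : Type} [Fintype ι] {E : ι → Type*}
    [∀ i, AddCommMonoid (E i)] [∀ i, Module ℂ (E i)] (a : ι → ℂ) (F : ∀ i, E i →ₗ[ℂ] E i) :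
    PiTensorProduct.map (fun i => a i • F i) = (∏ i, a i) • PiTensorProduct.map F :=
  (PiTensorProduct.mapMultilinear ℂ E E).map_smul_univ a F

end PolynomialFamilies

theorem apply_mem_span_orbit {G E : Type*} [AddCommMonoid E] [Module ℂ E] (ρ : G → E →ₗ[ℂ] E)
    (ξ : E) (hρ : ∀ f g, ∃ h, ρ h = ρ g ∘ₗ ρ f) (g : G) {x : E}
    (hx : x ∈ Submodule.span ℂ (Set.range fun f => ρ f ξ)) :
    ρ g x ∈ Submodule.span ℂ (Set.range fun f => ρ f ξ) := by
  induction hx using Submodule.span_induction with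
  | mem y hy =>
    obtain ⟨f, rfl⟩ := hy
    obtain ⟨h, hh⟩ := hρ f g
    exact Submodule.subset_span ⟨h, by simp [hh]⟩
  | zero => simp
  | add y z _ _ hy hz => rw [map_add]; exact Submodule.add_mem _ hy hz
  | smul c y _ hy => rw [map_smul]; exact Submodule.smul_mem _ c hy

section Representation

open scoped TensorProduct

variable (n : ℕ) (ν : ℕ → ℕ)

theorem exteriorPowerMap_ιMultiP {V W : Type*} [AddCommGroup V] [Module ℂ V] [AddCommGroup W]
    [Module ℂ W] (m : ℕ) (f : V →ₗ[ℂ] W) (x : Fin m → V) :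
    exteriorPowerMap m f (ιMultiP m x) = ιMultiP m (f ∘ x) :=
  Subtype.ext (ExteriorAlgebra.map_apply_ιMulti f x)

theorem exteriorPowerMap_trans {V : Type*} [AddCommGroup V] [Module ℂ V] (m : ℕ)
    (f g : V ≃ₗ[ℂ] V) :
    exteriorPowerMap m (f.trans g : V →ₗ[ℂ] V) =
      exteriorPowerMap m (g : V →ₗ[ℂ] V) ∘ₗ exteriorPowerMap m (f : V →ₗ[ℂ] V) := by
  refine LinearMap.ext fun x => Subtype.ext ?_
  exact (DFunLike.congr_fun (ExteriorAlgebra.map_comp_map (f : V →ₗ[ℂ] V) (g : V →ₗ[ℂ] V))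
    (x : ExteriorAlgebra ℂ V)).symm

theorem bigTensorOp_comp
    (L M : ∀ d : Fin n, (⋀[ℂ]^(d.1 + 1) (Fin n → ℂ)) →ₗ[ℂ] (⋀[ℂ]^(d.1 + 1) (Fin n → ℂ))) :
    bigTensorOp n ν (fun d => L d ∘ₗ M d) = bigTensorOp n ν L ∘ₗ bigTensorOp n ν M := by
  simp only [bigTensorOp, PiTensorProduct.map_comp]

theorem bigTensorOp_smul (a : Fin n → ℂ)
    (L : ∀ d : Fin n, (⋀[ℂ]^(d.1 + 1) (Fin n → ℂ)) →ₗ[ℂ] (⋀[ℂ]^(d.1 + 1) (Fin n → ℂ))) :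
    ∃ c : ℂ, bigTensorOp n ν (fun d => a d • L d) = c • bigTensorOp n ν L := by
  refine ⟨∏ d : Fin n, ∏ _i : Fin (ν (d.1 + 1) - ν (d.1 + 2)), a d, ?_⟩
  simp only [bigTensorOp, piTensorProduct_map_smul]

theorem rNu_trans (f g : (Fin n → ℂ) ≃ₗ[ℂ] (Fin n → ℂ)) :
    rNu n ν (f.trans g) = rNu n ν g ∘ₗ rNu n ν f := by
  rw [rNu, rNu, rNu, ← bigTensorOp_comp]
  exact congrArg (bigTensorOp n ν) (funext fun d => exteriorPowerMap_trans (d.1 + 1) f g)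

theorem rNu_mem_HNu (g : (Fin n → ℂ) ≃ₗ[ℂ] (Fin n → ℂ)) {x : FrakF n ν} (hx : x ∈ HNu n ν) :
    rNu n ν g x ∈ HNu n ν :=
  apply_mem_span_orbit (rNu n ν) (XiNu n ν) (fun f g => ⟨f.trans g, rNu_trans n ν f g⟩) g hx

theorem bigTensorOp_isPolyFamily
    {F : ∀ d : Fin n, ℂ → ((⋀[ℂ]^(d.1 + 1) (Fin n → ℂ)) →ₗ[ℂ] (⋀[ℂ]^(d.1 + 1) (Fin n → ℂ)))}
    (hF : ∀ d, IsPolyFamily (F d)) :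
    IsPolyFamily (fun s => bigTensorOp n ν (fun d => F d s)) :=
  IsPolyFamily.piTensorProduct_map fun d => IsPolyFamily.piTensorProduct_map fun _ => hF d

theorem bigTensorOp_mem_HNu_of_family
    {F : ∀ d : Fin n, ℂ → ((⋀[ℂ]^(d.1 + 1) (Fin n → ℂ)) →ₗ[ℂ] (⋀[ℂ]^(d.1 + 1) (Fin n → ℂ)))}
    (hF : ∀ d, IsPolyFamily (F d))
    (hg : ∀ s, s ≠ 0 → ∃ (g : (Fin n → ℂ) ≃ₗ[ℂ] (Fin n → ℂ)) (a : Fin n → ℂ),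
      ∀ d, F d s = a d • exteriorPowerMap (d.1 + 1) (g : (Fin n → ℂ) →ₗ[ℂ] (Fin n → ℂ)))
    {x : FrakF n ν} (hx : x ∈ HNu n ν) : bigTensorOp n ν (fun d => F d 0) x ∈ HNu n ν := by
  refine ((bigTensorOp_isPolyFamily n ν hF).linear (LinearMap.applyₗ x)).mem_submodule
    (HNu n ν) fun s hs => ?_
  obtain ⟨g, a, h⟩ := hg s hs
  obtain ⟨c, hc⟩ := bigTensorOp_smul n ν a
    (fun d => exteriorPowerMap (d.1 + 1) (g : (Fin n → ℂ) →ₗ[ℂ] (Fin n → ℂ)))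
  simp only [h, hc, LinearMap.applyₗ_apply_apply, LinearMap.smul_apply]
  exact (HNu n ν).smul_mem c (rNu_mem_HNu n ν g hx)

end Representation

section MonomialOperators

variable {V W : Type*} [AddCommGroup V] [Module ℂ V] [AddCommGroup W] [Module ℂ W]
  {ι : Type*} [Finite ι]

/-- There is an operator multiplying each basis monomial by a coefficient depending on its support
and replacing its factors by prescribed vectors. -/
theorem exists_monomial_operator (b : Basis ι ℂ V) (B : ι → W) (p : Set ι → ℂ) :
    ∃ T : ExteriorAlgebra ℂ V →ₗ[ℂ] ExteriorAlgebra ℂ W,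
      ∀ (r : ℕ) (x : Fin r → ι), Function.Injective x →
        T (ExteriorAlgebra.ιMulti ℂ r (b ∘ x)) =
          p (Set.range x) • ExteriorAlgebra.ιMulti ℂ r (B ∘ x) := by
  obtain ⟨hlin⟩ : Nonempty (LinearOrder ι) :=
    ⟨LinearOrder.lift' (Finite.equivFin ι) (Finite.equivFin ι).injective⟩
  refine ⟨b.ExteriorAlgebra.constr ℂ fun s => p (s : Set ι) • ExteriorAlgebra.ιMulti ℂ s.card
    (B ∘ s.orderEmbOfFin rfl), fun r x hx => ?_⟩
  obtain ⟨s, hs⟩ : ∃ s : Finset ι, s = Finset.univ.image x := ⟨_, rfl⟩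
  have hr : Set.range x = s := by simp [hs]
  have hcard : s.card = r := by
    rw [hs, Finset.card_image_of_injective _ hx, Finset.card_univ, Fintype.card_fin]
  obtain ⟨τ, hτ⟩ : ∃ τ : Equiv.Perm (Fin r), x = s.orderEmbOfFin hcard ∘ τ := by
    have hmem : ∀ i, ∃ j, s.orderEmbOfFin hcard j = x i := fun i => by
      have : x i ∈ Set.range (s.orderEmbOfFin hcard) := by
        rw [Finset.range_orderEmbOfFin]
        simp [hs]
      exact this
    choose τ hτ using hmem
    have hinj : Function.Injective τ := fun i j h => hx (by rw [← hτ i, ← hτ j, h])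
    exact ⟨Equiv.ofBijective τ (Finite.injective_iff_bijective.1 hinj),
      funext fun i => (hτ i).symm⟩
  have key : b.ExteriorAlgebra.constr ℂ (fun s => p (s : Set ι) • ExteriorAlgebra.ιMulti ℂ s.card
      (B ∘ s.orderEmbOfFin rfl)) (ExteriorAlgebra.ιMulti ℂ r (b ∘ s.orderEmbOfFin hcard)) =
      p (s : Set ι) • ExteriorAlgebra.ιMulti ℂ r (B ∘ s.orderEmbOfFin hcard) := by
    clear hτ hr hs
    subst hcard
    have h := ExteriorAlgebra.basis_apply_ofCard b (s := s) rfl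
    have h2 : b.ExteriorAlgebra s =
      ExteriorAlgebra.ιMulti ℂ s.card (b ∘ s.orderEmbOfFin rfl) := h
    rw [← h2, Basis.constr_basis]
  rw [hr, hτ, ← Function.comp_assoc, ← Function.comp_assoc, AlternatingMap.map_perm,
    AlternatingMap.map_perm, smul_comm, ← key]
  simp only [Units.smul_def, map_zsmul]

omit [Finite ι] in
theorem linearMap_ext_monomial {E : Type*} [AddCommGroup E] [Module ℂ E]
    (b : Basis ι ℂ V) {m : ℕ} {S T : (⋀[ℂ]^m V) →ₗ[ℂ] E}
    (h : ∀ x : Fin m → ι, Function.Injective x → S (ιMultiP m (b ∘ x)) = T (ιMultiP m (b ∘ x))) :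
    S = T := by
  refine exteriorPower.linearMap_ext (Basis.ext_alternating b fun x hx => ?_)
  exact h x hx

omit [Finite ι] in
theorem exists_monomial_operator_degree (b : Basis ι ℂ V) (B : ι → W) (m : ℕ)
    (T : ExteriorAlgebra ℂ V →ₗ[ℂ] ExteriorAlgebra ℂ W) (p : (Fin m → ι) → ℂ)
    (hT : ∀ x : Fin m → ι, Function.Injective x →
        T (ExteriorAlgebra.ιMulti ℂ m (b ∘ x)) = p x • ExteriorAlgebra.ιMulti ℂ m (B ∘ x)) :
    ∃ M : (⋀[ℂ]^m V) →ₗ[ℂ] (⋀[ℂ]^m W), ∀ z, (M z : ExteriorAlgebra ℂ W) = T z := by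
  have hmem : ∀ z ∈ ⋀[ℂ]^m V, T z ∈ ⋀[ℂ]^m W := by
    have h : (⋀[ℂ]^m W).mkQ ∘ₗ T ∘ₗ (⋀[ℂ]^m V).subtype = 0 := by
      refine linearMap_ext_monomial b fun x hx => ?_
      change (⋀[ℂ]^m W).mkQ (T (ExteriorAlgebra.ιMulti ℂ m (b ∘ x))) = 0
      rw [hT x hx, Submodule.mkQ_apply, Submodule.Quotient.mk_eq_zero]
      exact Submodule.smul_mem _ _ (ExteriorAlgebra.ιMulti_range ℂ m (Set.mem_range_self _))
    intro z hz
    simpa using DFunLike.congr_fun h ⟨z, hz⟩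
  exact ⟨T.restrict hmem, fun z => rfl⟩

end MonomialOperators

section MonomialOperatorRelations

variable {V W : Type*} [AddCommGroup V] [Module ℂ V] [AddCommGroup W] [Module ℂ W]
  {ι κ : Type*} [Finite ι] [Finite κ]

/-- `T` replaces `b l` by `B l` in every monomial containing all `b l` with `l ∈ lo`, and
annihilates every other monomial. -/
structure IsMonomialOp (b : ι → V) (B : ι → W) (lo : Set ι)
    (T : ExteriorAlgebra ℂ V →ₗ[ℂ] ExteriorAlgebra ℂ W) : Prop where
  apply_of_subset : ∀ (r : ℕ) (x : Fin r → ι), lo ⊆ Set.range x →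
    T (ExteriorAlgebra.ιMulti ℂ r (b ∘ x)) = ExteriorAlgebra.ιMulti ℂ r (B ∘ x)
  apply_of_not_subset : ∀ (r : ℕ) (x : Fin r → ι), ¬ lo ⊆ Set.range x →
    T (ExteriorAlgebra.ιMulti ℂ r (b ∘ x)) = 0

theorem ιMulti_comp_eq_zero {V : Type*} [AddCommGroup V] [Module ℂ V] {ι : Type*} (b : ι → V)
    {r : ℕ} {x : Fin r → ι} (hx : ¬ Function.Injective x) :
    ExteriorAlgebra.ιMulti ℂ r (b ∘ x) = 0 :=
  ExteriorAlgebra.ιMulti_eq_zero_of_not_inj fun h => hx h.of_comp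

theorem ι_mul_ιMulti_comp {V : Type*} [AddCommGroup V] [Module ℂ V] {ι : Type*} (b : ι → V)
    {r : ℕ} (l : ι) (x : Fin r → ι) :
    ExteriorAlgebra.ι ℂ (b l) * ExteriorAlgebra.ιMulti ℂ r (b ∘ x) =
      ExteriorAlgebra.ιMulti ℂ (r + 1) (b ∘ (Fin.cons l x : Fin (r + 1) → ι)) := by
  rw [ExteriorAlgebra.ιMulti_succ_apply]
  rfl

theorem exists_isMonomialOp (b : Basis ι ℂ V) (B : ι → W) (lo : Set ι) :
    ∃ T : ExteriorAlgebra ℂ V →ₗ[ℂ] ExteriorAlgebra ℂ W, IsMonomialOp b B lo T := by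
  classical
  obtain ⟨T, hT⟩ := exists_monomial_operator b B fun s => if lo ⊆ s then 1 else 0
  refine ⟨T, fun r x h => ?_, fun r x h => ?_⟩
  · by_cases hx : Function.Injective x
    · simp [hT r x hx, h]
    · simp [ιMulti_comp_eq_zero _ hx]
  · by_cases hx : Function.Injective x
    · simp [hT r x hx, h]
    · simp [ιMulti_comp_eq_zero _ hx]

theorem exteriorAlgebra_linearMap_ext_monomial {E : Type*} [AddCommGroup E] [Module ℂ E]
    (b : Basis ι ℂ V) {S T : ExteriorAlgebra ℂ V →ₗ[ℂ] E}
    (h : ∀ (r : ℕ) (x : Fin r → ι), S (ExteriorAlgebra.ιMulti ℂ r (b ∘ x)) =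
      T (ExteriorAlgebra.ιMulti ℂ r (b ∘ x))) : S = T := by
  obtain ⟨hlin⟩ : Nonempty (LinearOrder ι) :=
    ⟨LinearOrder.lift' (Finite.equivFin ι) (Finite.equivFin ι).injective⟩
  refine b.ExteriorAlgebra.ext fun s => ?_
  rw [ExteriorAlgebra.basis_apply]
  exact h _ _

theorem IsMonomialOp.ι_mul {b : Basis ι ℂ V} {B : ι → W} {lo : Set ι}
    {T : ExteriorAlgebra ℂ V →ₗ[ℂ] ExteriorAlgebra ℂ W} (hT : IsMonomialOp b B lo T)
    {l : ι} (hl : l ∉ lo) (z : ExteriorAlgebra ℂ V) :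
    T (ExteriorAlgebra.ι ℂ (b l) * z) = ExteriorAlgebra.ι ℂ (B l) * T z := by
  suffices h : T ∘ₗ LinearMap.mulLeft ℂ (ExteriorAlgebra.ι ℂ (b l)) =
      LinearMap.mulLeft ℂ (ExteriorAlgebra.ι ℂ (B l)) ∘ₗ T from DFunLike.congr_fun h z
  refine exteriorAlgebra_linearMap_ext_monomial b fun r x => ?_
  simp only [LinearMap.comp_apply, LinearMap.mulLeft_apply]
  have hiff : lo ⊆ Set.range (Fin.cons l x : Fin (r + 1) → ι) ↔ lo ⊆ Set.range x := by
    rw [Fin.range_cons]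
    exact Set.subset_insert_iff_of_notMem hl
  by_cases hx : lo ⊆ Set.range x
  · rw [ι_mul_ιMulti_comp, hT.apply_of_subset _ _ (hiff.2 hx), hT.apply_of_subset _ _ hx,
      ι_mul_ιMulti_comp]
  · rw [ι_mul_ιMulti_comp, hT.apply_of_not_subset _ _ (hiff.not.2 hx),
      hT.apply_of_not_subset _ _ hx, mul_zero]

theorem IsMonomialOp.ι_mul_eq_zero {b : Basis ι ℂ V} {B : ι → W} {lo : Set ι}
    {T : ExteriorAlgebra ℂ V →ₗ[ℂ] ExteriorAlgebra ℂ W} (hT : IsMonomialOp b B lo T)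
    {l : ι} (hl : l ∈ lo) (z : ExteriorAlgebra ℂ V) :
    ExteriorAlgebra.ι ℂ (B l) * T z = 0 := by
  suffices h : LinearMap.mulLeft ℂ (ExteriorAlgebra.ι ℂ (B l)) ∘ₗ T = 0 from
    DFunLike.congr_fun h z
  refine exteriorAlgebra_linearMap_ext_monomial b fun r x => ?_
  simp only [LinearMap.comp_apply, LinearMap.mulLeft_apply, LinearMap.zero_apply]
  by_cases hx : lo ⊆ Set.range x
  · obtain ⟨p, rfl⟩ := hx hl
    rw [hT.apply_of_subset _ _ hx]
    exact ExteriorAlgebra.ι_mul_prod_list (B ∘ x) p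
  · rw [hT.apply_of_not_subset _ _ hx, mul_zero]

theorem IsMonomialOp.ι_mul_of_mem_span {b : Basis ι ℂ V} {B : ι → W} {lo : Set ι}
    {T : ExteriorAlgebra ℂ V →ₗ[ℂ] ExteriorAlgebra ℂ W} (hT : IsMonomialOp b B lo T)
    {q : V × W} (hq : q ∈ Submodule.span ℂ ((fun l => ((0 : V), B l)) '' lo ∪
      (fun l => (b l, B l)) '' loᶜ)) (z : ExteriorAlgebra ℂ V) :
    T (ExteriorAlgebra.ι ℂ q.1 * z) = ExteriorAlgebra.ι ℂ q.2 * T z := by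
  induction hq using Submodule.span_induction with
  | mem y hy =>
    rcases hy with ⟨l, hl, rfl⟩ | ⟨l, hl, rfl⟩
    · simp [hT.ι_mul_eq_zero hl]
    · exact hT.ι_mul hl z
  | zero => simp
  | add y y' _ _ hy hy' => simp [add_mul, hy, hy']
  | smul c y _ hy => simp [hy]

theorem exists_injective_range_eq {ι : Type*} [Finite ι] {s : Set ι} {r : ℕ} (h : s.ncard = r) :
    ∃ y : Fin r → ι, Function.Injective y ∧ Set.range y = s := by
  have f := (Finite.equivFinOfCardEq ((Nat.card_coe_set_eq s).trans h)).symm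
  refine ⟨Subtype.val ∘ f, Subtype.val_injective.comp f.injective, ?_⟩
  rw [Set.range_comp, f.range_eq_univ, Set.image_univ, Subtype.range_coe]

theorem exists_perm_of_range_eq {ι : Type*} {r : ℕ} {x y : Fin r → ι}
    (hx : Function.Injective x) (h : Set.range x = Set.range y) :
    ∃ τ : Equiv.Perm (Fin r), x = y ∘ τ := by
  have hmem : ∀ i, ∃ j, y j = x i := fun i => by
    have : x i ∈ Set.range y := h ▸ Set.mem_range_self i
    exact this
  choose τ hτ using hmem
  have hinj : Function.Injective τ := fun i j hij => hx (by rw [← hτ i, ← hτ j, hij])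
  exact ⟨Equiv.ofBijective τ (Finite.injective_iff_bijective.1 hinj),
    funext fun i => (hτ i).symm⟩

theorem alternatingMap_eq_det_smul {r : ℕ} {M N : Type*} [AddCommGroup M] [Module ℂ M]
    [AddCommGroup N] [Module ℂ N] (e : Basis (Fin r) ℂ M) (f : M [⋀^Fin r]→ₗ[ℂ] N)
    (v : Fin r → M) : f v = e.det v • f e := by
  have h : f = (LinearMap.toSpanSingleton ℂ N (f e)).compAlternatingMap e.det := by
    refine Basis.ext_alternating e fun i h => ?_
    obtain ⟨σ, hσ⟩ : ∃ σ : Equiv.Perm (Fin r), ⇑σ = i :=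
      ⟨Equiv.ofBijective i (Finite.injective_iff_bijective.1 h), rfl⟩
    subst hσ
    change f (e ∘ σ) = e.det (e ∘ σ) • f e
    rw [AlternatingMap.map_perm, AlternatingMap.map_perm, Basis.det_self, Units.smul_def,
      Units.smul_def]
    simp [Int.cast_smul_eq_zsmul]
  conv_lhs => rw [h]
  rfl

theorem ιMulti_eq_smul_of_mem_span {V : Type*} [AddCommGroup V] [Module ℂ V] {r : ℕ}
    {u y : Fin r → V} (h : ∀ p, u p ∈ Submodule.span ℂ (Set.range y)) :
    ∃ a : ℂ, ExteriorAlgebra.ιMulti ℂ r u = a • ExteriorAlgebra.ιMulti ℂ r y := by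
  have hA : ∀ p, ∃ c : Fin r → ℂ, Fintype.linearCombination ℂ y c = u p := fun p => by
    have := h p
    rw [← Fintype.range_linearCombination] at this
    exact this
  choose A hA using hA
  refine ⟨(Pi.basisFun ℂ (Fin r)).det A, ?_⟩
  have hu : u = Fintype.linearCombination ℂ y ∘ A := funext fun p => (hA p).symm
  have hy : Fintype.linearCombination ℂ y ∘ Pi.basisFun ℂ (Fin r) = y := by
    ext p
    simp [Fintype.linearCombination_apply_single]
  have := alternatingMap_eq_det_smul (Pi.basisFun ℂ (Fin r))
    ((ExteriorAlgebra.ιMulti ℂ r).compLinearMap (Fintype.linearCombination ℂ y)) A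
  rw [hu]
  conv_rhs => rw [← hy]
  exact this

omit [Finite ι] in
theorem IsMonomialOp.apply_eq_zero {b : Basis ι ℂ V} {B : ι → W} {lo : Set ι}
    {T : ExteriorAlgebra ℂ V →ₗ[ℂ] ExteriorAlgebra ℂ W} (hT : IsMonomialOp b B lo T)
    {r : ℕ} (hr : r < lo.ncard) (u : Fin r → V) : T (ExteriorAlgebra.ιMulti ℂ r u) = 0 := by
  suffices h : T.compAlternatingMap (ExteriorAlgebra.ιMulti ℂ r) = 0 from DFunLike.congr_fun h u
  refine Basis.ext_alternating b fun x _ => hT.apply_of_not_subset r x fun hx => ?_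
  have h1 := Set.ncard_le_ncard hx
  have h2 : (Set.range x).ncard ≤ r := by
    simpa [← Set.image_univ] using Set.ncard_image_le (f := x) (Set.finite_univ)
  omega

omit [Finite ι] in
theorem IsMonomialOp.apply_eq_smul {b : Basis ι ℂ V} {B : ι → W} {lo : Set ι}
    {T : ExteriorAlgebra ℂ V →ₗ[ℂ] ExteriorAlgebra ℂ W} (hT : IsMonomialOp b B lo T)
    {r : ℕ} {y : Fin r → ι} (hy : Function.Injective y) (hlo : Set.range y = lo)
    (u : Fin r → V) :
    ∃ a : ℂ, T (ExteriorAlgebra.ιMulti ℂ r u) = a • ExteriorAlgebra.ιMulti ℂ r (B ∘ y) := by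
  set N := Submodule.span ℂ {ExteriorAlgebra.ιMulti ℂ r (B ∘ y)} with hN
  suffices h : (N.mkQ ∘ₗ T).compAlternatingMap (ExteriorAlgebra.ιMulti ℂ r) = 0 by
    have h' := DFunLike.congr_fun h u
    change N.mkQ (T (ExteriorAlgebra.ιMulti ℂ r u)) = 0 at h'
    rw [Submodule.mkQ_apply, Submodule.Quotient.mk_eq_zero, hN, Submodule.mem_span_singleton] at h'
    obtain ⟨a, ha⟩ := h'
    exact ⟨a, ha.symm⟩
  refine Basis.ext_alternating b fun x hx => ?_
  change N.mkQ (T (ExteriorAlgebra.ιMulti ℂ r (b ∘ x))) = 0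
  rw [Submodule.mkQ_apply, Submodule.Quotient.mk_eq_zero]
  by_cases hs : lo ⊆ Set.range x
  · rw [hT.apply_of_subset r x hs]
    have hxy : Set.range y = Set.range x := by
      refine Set.eq_of_subset_of_ncard_le (hlo ▸ hs) ?_
      rw [← Set.image_univ, ← Set.image_univ, Set.ncard_image_of_injective _ hx,
        Set.ncard_image_of_injective _ hy]
    obtain ⟨τ, rfl⟩ := exists_perm_of_range_eq hx hxy.symm
    rw [← Function.comp_assoc, AlternatingMap.map_perm, Units.smul_def]
    exact zsmul_mem (Submodule.mem_span_singleton_self _) _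
  · rw [hT.apply_of_not_subset r x hs]
    exact N.zero_mem

theorem eq_smul_of_ι_mul {e : Basis κ ℂ V} {E : κ → W} {lo : Set κ}
    {T T' : ExteriorAlgebra ℂ V →ₗ[ℂ] ExteriorAlgebra ℂ W} (c : ℂ)
    (hT : ∀ l ∉ lo, ∀ z, T (ExteriorAlgebra.ι ℂ (e l) * z) = ExteriorAlgebra.ι ℂ (E l) * T z)
    (hT' : ∀ l ∉ lo, ∀ z, T' (ExteriorAlgebra.ι ℂ (e l) * z) = ExteriorAlgebra.ι ℂ (E l) * T' z)
    (h : ∀ (r : ℕ) (x : Fin r → κ), Set.range x ⊆ lo →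
      T (ExteriorAlgebra.ιMulti ℂ r (e ∘ x)) = c • T' (ExteriorAlgebra.ιMulti ℂ r (e ∘ x))) :
    T = c • T' := by
  refine exteriorAlgebra_linearMap_ext_monomial e fun r => ?_
  induction r with
  | zero => exact fun x => h 0 x (by simp)
  | succ r ih =>
    intro x
    by_cases hx : Set.range x ⊆ lo
    · exact h _ x hx
    obtain ⟨_, ⟨p, rfl⟩, hp⟩ := Set.not_subset.1 hx
    have key : T (ExteriorAlgebra.ιMulti ℂ (r + 1) (e ∘ (x ∘ Equiv.swap 0 p))) =
        (c • T') (ExteriorAlgebra.ιMulti ℂ (r + 1) (e ∘ (x ∘ Equiv.swap 0 p))) := by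
      have hcons : x ∘ Equiv.swap 0 p =
          (Fin.cons (x p) (Fin.tail (x ∘ Equiv.swap 0 p)) : Fin (r + 1) → κ) := by
        conv_lhs => rw [← Fin.cons_self_tail (x ∘ Equiv.swap 0 p)]
        simp
      rw [hcons, ← ι_mul_ιMulti_comp, LinearMap.smul_apply, hT _ hp, hT' _ hp, ih]
      simp
    rw [← Function.comp_assoc, AlternatingMap.map_perm, Units.smul_def, map_zsmul,
      map_zsmul] at key
    rcases Int.units_eq_one_or (Equiv.Perm.sign (Equiv.swap 0 p)) with hs | hs <;>
      simpa [hs] using key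

theorem IsMonomialOp.exists_eq_smul {b : Basis ι ℂ V} {B : ι → W} {lo : Set ι}
    {T T' : ExteriorAlgebra ℂ V →ₗ[ℂ] ExteriorAlgebra ℂ W} (hT : IsMonomialOp b B lo T)
    {e : Basis κ ℂ V} {E : κ → W} {lo' : Set κ} (hT' : IsMonomialOp e E lo' T')
    (hcard : lo.ncard = lo'.ncard) (hB : ∀ l ∈ lo, B l ∈ Submodule.span ℂ (E '' lo'))
    (hE : ∀ l ∉ lo', (e l, E l) ∈ Submodule.span ℂ ((fun l => ((0 : V), B l)) '' lo ∪
      (fun l => (b l, B l)) '' loᶜ)) :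
    ∃ c : ℂ, T = c • T' := by
  obtain ⟨y, hy, hylo⟩ := exists_injective_range_eq hcard
  obtain ⟨x₀, -, hxlo⟩ := exists_injective_range_eq (s := lo') rfl
  obtain ⟨a, ha⟩ := hT.apply_eq_smul hy hylo (e ∘ x₀)
  obtain ⟨a', ha'⟩ : ∃ a : ℂ, ExteriorAlgebra.ιMulti ℂ _ (B ∘ y) =
      a • ExteriorAlgebra.ιMulti ℂ _ (E ∘ x₀) := by
    refine ιMulti_eq_smul_of_mem_span fun p => ?_
    rw [Set.range_comp, hxlo]
    exact hB _ (hylo ▸ Set.mem_range_self p)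
  refine ⟨a * a', eq_smul_of_ι_mul (lo := lo') _
    (fun l hl z => hT.ι_mul_of_mem_span (hE l hl) z) (fun l hl z => hT'.ι_mul hl z)
    fun r x hx => ?_⟩
  by_cases hinj : Function.Injective x
  · have hr : (Set.range x).ncard = r := by
      rw [← Set.image_univ, Set.ncard_image_of_injective _ hinj]
      simp
    rcases (hr ▸ Set.ncard_le_ncard hx : r ≤ lo'.ncard).lt_or_eq with hlt | heq
    · rw [hT.apply_eq_zero (hcard ▸ hlt), hT'.apply_eq_zero hlt, smul_zero]
    · subst heq
      obtain ⟨τ, rfl⟩ := exists_perm_of_range_eq hinj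
        ((Set.eq_of_subset_of_ncard_le hx hr.ge).trans hxlo.symm)
      rw [← Function.comp_assoc, AlternatingMap.map_perm, Units.smul_def, map_zsmul, map_zsmul,
        ha, ha', hT'.apply_of_subset _ _ hxlo.ge, smul_comm (a * a'), smul_smul]
  · simp [ιMulti_comp_eq_zero _ hinj]

end MonomialOperatorRelations

section AdaptedBases

variable {V W : Type*} [AddCommGroup V] [Module ℂ V] [AddCommGroup W] [Module ℂ W]

theorem mem_relKer {S : Submodule ℂ (V × W)} {v : V} : v ∈ relKer S ↔ (v, 0) ∈ S := Iff.rfl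

theorem mem_relIndef {S : Submodule ℂ (V × W)} {w : W} : w ∈ relIndef S ↔ (0, w) ∈ S := Iff.rfl

theorem mem_relDom {S : Submodule ℂ (V × W)} {v : V} : v ∈ relDom S ↔ ∃ w, (v, w) ∈ S := by
  simp [relDom]

theorem mem_relIm {S : Submodule ℂ (V × W)} {w : W} : w ∈ relIm S ↔ ∃ v, (v, w) ∈ S := by
  simp [relIm]

theorem relKer_le_relDom (S : Submodule ℂ (V × W)) : relKer S ≤ relDom S :=
  fun _ h => mem_relDom.2 ⟨0, h⟩

theorem relIndef_le_relIm (S : Submodule ℂ (V × W)) : relIndef S ≤ relIm S :=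
  fun _ h => mem_relIm.2 ⟨0, h⟩

theorem sum_smul_prod_mem {ι : Type*} [Fintype ι] {S : Submodule ℂ (V × W)} {g : ι → V} {G : ι → W}
    (h : ∀ p, (g p, G p) ∈ S) (c : ι → ℂ) : (∑ p, c p • g p, ∑ p, c p • G p) ∈ S := by
  have : (∑ p, c p • g p, ∑ p, c p • G p) = ∑ p, c p • (g p, G p) := by
    ext <;> simp [Prod.fst_sum, Prod.snd_sum]
  rw [this]
  exact S.sum_mem fun p _ => S.smul_mem _ (h p)

/-- Families adapted to the indefiniteness and the domain of a linear relation extend to families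
adapted to its image and its kernel. -/
theorem exists_extension_of_relation [FiniteDimensional ℂ V] (S : Submodule ℂ (V × W)) {ι : Type*}
    {e : ι → V} {E : ι → W} (hE : LinearIndependent ℂ E)
    (hEspan : Submodule.span ℂ (Set.range E) = relIndef S) (he : LinearIndependent ℂ e)
    (hdisj : Disjoint (Submodule.span ℂ (Set.range e)) (relDom S)) :
    ∃ (β : ℕ) (g : Fin β → V) (G : Fin β → W), (∀ p, (g p, G p) ∈ S) ∧
      LinearIndependent ℂ (Sum.elim E G) ∧
      Submodule.span ℂ (Set.range (Sum.elim E G)) = relIm S ∧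
      LinearIndependent ℂ (Sum.elim e g) ∧
      Disjoint (Submodule.span ℂ (Set.range (Sum.elim e g))) (relKer S) := by
  obtain ⟨C₀, hC₀⟩ := Submodule.exists_isCompl (relKer S)
  obtain ⟨C, hC⟩ : ∃ C, C = C₀ ⊓ relDom S := ⟨_, rfl⟩
  have hsup : C ⊔ relKer S = relDom S := by
    rw [hC, inf_comm, inf_sup_assoc_of_le _ (relKer_le_relDom S), sup_comm, hC₀.sup_eq_top,
      inf_top_eq]
  have hCK : Disjoint C (relKer S) := hC₀.disjoint.symm.mono_left (hC ▸ inf_le_left)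
  obtain ⟨g, hg⟩ : ∃ g : Fin (finrank ℂ C) → V, g = C.subtype ∘ finBasis ℂ C := ⟨_, rfl⟩
  have hgli : LinearIndependent ℂ g := by
    rw [hg]
    exact (finBasis ℂ C).linearIndependent.map' _ C.ker_subtype
  have hgspan : Submodule.span ℂ (Set.range g) = C := by
    rw [hg, Set.range_comp, Submodule.span_image, (finBasis ℂ C).span_eq, Submodule.map_top,
      Submodule.range_subtype]
  have hgC : ∀ p, g p ∈ C := fun p => hgspan ▸ Submodule.subset_span (Set.mem_range_self p)
  have hlift : ∀ p, ∃ w, (g p, w) ∈ S := fun p =>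
    mem_relDom.1 (hsup ▸ Submodule.mem_sup_left (hgC p))
  choose G hG using hlift
  have key : ∀ c : Fin (finrank ℂ C) → ℂ, ∑ p, c p • G p ∈ relIndef S → ∀ p, c p = 0 := by
    intro c hc
    refine Fintype.linearIndependent_iff.1 hgli c ?_
    refine Submodule.disjoint_def.1 hCK _ (C.sum_mem fun p _ => C.smul_mem _ (hgC p)) ?_
    simpa [mem_relKer] using S.sub_mem (sum_smul_prod_mem hG c) (mem_relIndef.1 hc)
  refine ⟨_, g, G, hG, ?_, ?_, ?_, ?_⟩
  · refine LinearIndependent.sum_type hE (Fintype.linearIndependent_iff.2 fun c hc => key c ?_) ?_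
    · rw [hc]
      exact Submodule.zero_mem _
    · rw [hEspan, Submodule.disjoint_def]
      intro y hy hy'
      obtain ⟨c, rfl⟩ := (Submodule.mem_span_range_iff_exists_fun ℂ).1 hy'
      simp [key c hy]
  · rw [Set.Sum.elim_range, Submodule.span_union, hEspan]
    refine le_antisymm (sup_le (relIndef_le_relIm S) (Submodule.span_le.2 ?_)) fun y hy => ?_
    · rintro _ ⟨p, rfl⟩
      exact mem_relIm.2 ⟨_, hG p⟩
    · obtain ⟨v, hv⟩ := mem_relIm.1 hy
      have hvD : v ∈ C ⊔ relKer S := hsup ▸ mem_relDom.2 ⟨y, hv⟩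
      obtain ⟨a, ha, u, hu, rfl⟩ := Submodule.mem_sup.1 hvD
      rw [← hgspan] at ha
      obtain ⟨c, rfl⟩ := (Submodule.mem_span_range_iff_exists_fun ℂ).1 ha
      have h1 : y - ∑ p, c p • G p ∈ relIndef S := by
        simpa [mem_relIndef] using
          S.sub_mem (S.sub_mem hv (mem_relKer.1 hu)) (sum_smul_prod_mem hG c)
      rw [← sub_add_cancel y (∑ p, c p • G p)]
      refine Submodule.add_mem_sup h1 ?_
      exact (Submodule.mem_span_range_iff_exists_fun ℂ).2 ⟨c, rfl⟩
  · refine LinearIndependent.sum_type he hgli ?_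
    rw [hgspan]
    exact hdisj.mono_right (hsup ▸ le_sup_left)
  · rw [Set.Sum.elim_range, Submodule.span_union, hgspan]
    refine (hCK.symm.disjoint_sup_right_of_disjoint_sup_left ?_).symm.mono_left
      (sup_comm _ _).le
    rw [sup_comm, hsup]
    exact hdisj.symm

theorem finrank_relDom_add_finrank_relIndef [FiniteDimensional ℂ V] [FiniteDimensional ℂ W]
    (S : Submodule ℂ (V × W)) : finrank ℂ (relDom S) + finrank ℂ (relIndef S) = finrank ℂ S := by
  have h := LinearMap.finrank_range_add_finrank_ker ((LinearMap.fst ℂ V W).domRestrict S)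
  rw [LinearMap.range_domRestrict] at h
  rw [← h]
  congr 1
  refine LinearEquiv.finrank_eq
    { toFun := fun w => ⟨⟨(0, w.1), w.2⟩, by simp⟩
      map_add' := fun x y => by ext <;> simp
      map_smul' := fun c x => by ext <;> simp
      invFun := fun z => ⟨z.1.1.2, by
        obtain ⟨⟨⟨a, b⟩, hz⟩, ha⟩ := z
        obtain rfl : a = 0 := by simpa using ha
        exact hz⟩
      left_inv := fun _ => rfl
      right_inv := fun z => by
        obtain ⟨⟨⟨a, b⟩, hz⟩, ha⟩ := z
        obtain rfl : a = 0 := by simpa using ha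
        rfl }

variable [FiniteDimensional ℂ V] {k : ℕ} {P : Fin k → Submodule ℂ (V × V)}

theorem IsHinge.exists_adapted_families (hP : IsHinge P) (j : ℕ) (hj : j < k) :
    ∃ (ι : Type) (_ : Finite ι) (e E : ι → V) (w : ι → Fin k), (∀ l, (e l, E l) ∈ P (w l)) ∧
      LinearIndependent ℂ E ∧ Submodule.span ℂ (Set.range E) = relIm (P ⟨j, hj⟩) ∧
      LinearIndependent ℂ e ∧ Disjoint (Submodule.span ℂ (Set.range e)) (relKer (P ⟨j, hj⟩)) := by
  induction j with
  | zero =>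
    have h0 : relIndef (P ⟨0, hj⟩) = ⊥ := by
      have h := finrank_relDom_add_finrank_relIndef (P ⟨0, hj⟩)
      rw [hP.dim_eq, hP.dom_first, finrank_top] at h
      exact Submodule.finrank_eq_zero.1 (by omega)
    obtain ⟨β, g, G, hgG, hG, hGspan, hg, hgdisj⟩ :=
      exists_extension_of_relation (P ⟨0, hj⟩) (ι := Empty) (e := Empty.elim) (E := Empty.elim)
        linearIndependent_empty_type (by simp [h0, Set.range_eq_empty])
        linearIndependent_empty_type (by simp [Set.range_eq_empty])
    exact ⟨Empty ⊕ Fin β, inferInstance, _, _, fun _ => ⟨0, hj⟩,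
      by rintro (l | l); exacts [l.elim, hgG l], hG, hGspan, hg, hgdisj⟩
  | succ j ih =>
    obtain ⟨ι, _, e, E, w, hw, hE, hEspan, he, hdisj⟩ := ih (by omega)
    rw [hP.im_eq_indef j hj] at hEspan
    rw [hP.ker_eq_dom j hj] at hdisj
    obtain ⟨β, g, G, hgG, hG, hGspan, hg, hgdisj⟩ :=
      exists_extension_of_relation (P ⟨j + 1, hj⟩) hE hEspan he hdisj
    exact ⟨ι ⊕ Fin β, inferInstance, _, _, Sum.elim w fun _ => ⟨j + 1, hj⟩,
      by rintro (l | l); exacts [hw l, hgG l], hG, hGspan, hg, hgdisj⟩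

/-- A hinge admits a pair of bases decomposing all of its terms simultaneously. -/
theorem IsHinge.exists_adapted_bases (hP : IsHinge P) :
    ∃ (ι : Type) (_ : Finite ι) (e E : Basis ι ℂ V) (w : ι → Fin k),
      ∀ l, (e l, E l) ∈ P (w l) := by
  obtain ⟨ι, _, e, E, w, hw, hE, hEspan, he, -⟩ :=
    hP.exists_adapted_families (k - 1) (Nat.sub_lt hP.pos one_pos)
  rw [hP.im_last] at hEspan
  have := Fintype.ofFinite ι
  obtain ⟨bE, hbE⟩ : ∃ b : Basis ι ℂ V, ⇑b = E := ⟨_, Basis.coe_mk hE hEspan.ge⟩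
  have hcard : Fintype.card ι = finrank ℂ V := (finrank_eq_card_basis bE).symm
  obtain ⟨be, hbe⟩ : ∃ b : Basis ι ℂ V, ⇑b = e :=
    ⟨_, Basis.coe_mk he (he.span_eq_top_of_card_eq_finrank' hcard).ge⟩
  exact ⟨ι, inferInstance, be, bE, w, by simpa [hbE, hbe] using hw⟩

omit [FiniteDimensional ℂ V] in
theorem IsHinge.relDom_antitone (hP : IsHinge P) {i j : ℕ} (hij : i ≤ j) (hj : j < k) :
    relDom (P ⟨j, hj⟩) ≤ relDom (P ⟨i, hij.trans_lt hj⟩) := by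
  induction j, hij using Nat.le_induction with
  | base => exact le_rfl
  | succ j hij ih =>
    refine le_trans ?_ (ih (by omega))
    rw [← hP.ker_eq_dom j hj]
    exact relKer_le_relDom _

omit [FiniteDimensional ℂ V] in
theorem IsHinge.relIndef_monotone (hP : IsHinge P) {i j : ℕ} (hij : i ≤ j) (hj : j < k) :
    relIndef (P ⟨i, hij.trans_lt hj⟩) ≤ relIndef (P ⟨j, hj⟩) := by
  induction j, hij using Nat.le_induction with
  | base => exact le_rfl
  | succ j hij ih =>
    refine le_trans (ih (by omega)) ?_
    rw [← hP.im_eq_indef j hj]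
    exact relIndef_le_relIm _

omit [FiniteDimensional ℂ V] in
theorem IsHinge.mem_of_lt (hP : IsHinge P) {i j : Fin k} (hij : i < j) {v w : V}
    (h : (v, w) ∈ P j) : (v, 0) ∈ P i := by
  have h1 : v ∈ relDom (P ⟨i + 1, by omega⟩) :=
    hP.relDom_antitone (i := i + 1) hij j.2 (mem_relDom.2 ⟨w, h⟩)
  rw [← hP.ker_eq_dom i (by omega)] at h1
  exact h1

omit [FiniteDimensional ℂ V] in
theorem IsHinge.mem_of_gt (hP : IsHinge P) {i j : Fin k} (hij : j < i) {v w : V}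
    (h : (v, w) ∈ P j) : (0, w) ∈ P i := by
  have h1 : w ∈ relIm (P ⟨j, by omega⟩) := mem_relIm.2 ⟨v, h⟩
  rw [hP.im_eq_indef j (by omega)] at h1
  exact hP.relIndef_monotone (i := j + 1) hij i.2 h1

end AdaptedBases

section GeneratingFamilies

variable {V W : Type*} [AddCommGroup V] [Module ℂ V] [AddCommGroup W] [Module ℂ W]

theorem relIndef_span_range {ι : Type*} [Fintype ι] {b : ι → V} {B : ι → W} {lo : Set ι}
    (hlo : ∀ l ∈ lo, b l = 0) (hb : ∀ c : ι → ℂ, ∑ l, c l • b l = 0 → ∀ l ∉ lo, c l = 0) :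
    relIndef (Submodule.span ℂ (Set.range fun l => (b l, B l))) = Submodule.span ℂ (B '' lo) := by
  refine le_antisymm (fun y hy => ?_) (Submodule.span_le.2 ?_)
  · obtain ⟨c, hc⟩ := (Submodule.mem_span_range_iff_exists_fun ℂ).1 (mem_relIndef.1 hy)
    have h1 : ∑ l, c l • b l = 0 := by simpa [Prod.fst_sum] using congrArg Prod.fst hc
    have h2 : ∑ l, c l • B l = y := by simpa [Prod.snd_sum] using congrArg Prod.snd hc
    rw [← h2]
    refine Submodule.sum_mem _ fun l _ => ?_
    by_cases hl : l ∈ lo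
    · exact Submodule.smul_mem _ _ (Submodule.subset_span (Set.mem_image_of_mem _ hl))
    · simp [hb c h1 l hl]
  · rintro _ ⟨l, hl, rfl⟩
    exact mem_relIndef.2 (Submodule.subset_span ⟨l, by simp [hlo l hl]⟩)

theorem linearIndependent_prod_of_forall {ι : Type*} [Fintype ι] {b : ι → V} {B : ι → W}
    {lo : Set ι} (hb : ∀ c : ι → ℂ, ∑ l, c l • b l = 0 → ∀ l ∉ lo, c l = 0)
    (hB : ∀ c : ι → ℂ, ∑ l, c l • B l = 0 → ∀ l ∈ lo, c l = 0) :
    LinearIndependent ℂ fun l => (b l, B l) := by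
  refine Fintype.linearIndependent_iff.2 fun c hc l => ?_
  by_cases hl : l ∈ lo
  · exact hB c (by simpa [Prod.snd_sum] using congrArg Prod.snd hc) l hl
  · exact hb c (by simpa [Prod.fst_sum] using congrArg Prod.fst hc) l hl

namespace CanonicalBasisPair

variable {S : Submodule ℂ (V × W)} (c : CanonicalBasisPair S)

/-- The first components of the standard generators of a relation with a canonical basis pair. -/
noncomputable def genV : Fin c.μ ⊕ Fin c.β ⊕ Fin c.γ → V :=
  Sum.elim 0 (c.bV ∘ Sum.inr)

/-- The second components of the standard generators of a relation with a canonical basis pair. -/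
noncomputable def genW : Fin c.μ ⊕ Fin c.β ⊕ Fin c.γ → W :=
  Sum.elim (c.bW ∘ Sum.inl) (Sum.elim (c.bW ∘ Sum.inr ∘ Sum.inl) 0)

theorem eq_span_range_gen : S = Submodule.span ℂ (Set.range fun l => (c.genV l, c.genW l)) := by
  conv_lhs => rw [c.hspan]
  congr 1
  ext q
  simp [genV, genW, or_assoc]

theorem sum_smul_genV {a : Fin c.μ ⊕ Fin c.β ⊕ Fin c.γ → ℂ} (h : ∑ l, a l • c.genV l = 0) :
    ∀ l ∉ Set.range Sum.inl, a l = 0 := by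
  have hli : LinearIndependent ℂ (c.bV ∘ Sum.inr) :=
    c.bV.linearIndependent.comp _ Sum.inr_injective
  have := Fintype.linearIndependent_iff.1 hli (a ∘ Sum.inr)
    (by rw [Fintype.sum_sum_type] at h; simpa [genV] using h)
  rintro (l | l) hl
  · exact absurd (Set.mem_range_self l) hl
  · exact this l

theorem sum_smul_genW {a : Fin c.μ ⊕ Fin c.β ⊕ Fin c.γ → ℂ} (h : ∑ l, a l • c.genW l = 0) :
    ∀ l ∈ Set.range Sum.inl, a l = 0 := by
  have := Fintype.linearIndependent_iff.1 c.bW.linearIndependent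
    (Sum.elim (a ∘ Sum.inl) (Sum.elim (a ∘ Sum.inr ∘ Sum.inl) 0))
    (by simpa [genW, Fintype.sum_sum_type] using h)
  rintro _ ⟨l, rfl⟩
  exact this (Sum.inl l)

theorem relIndef_eq : relIndef S = Submodule.span ℂ (Set.range (c.bW ∘ Sum.inl)) := by
  conv_lhs => rw [c.eq_span_range_gen]
  rw [relIndef_span_range (lo := Set.range Sum.inl) (by rintro _ ⟨l, rfl⟩; rfl)
    fun a => c.sum_smul_genV, ← Set.range_comp]
  rfl

theorem finrank_relIndef : finrank ℂ (relIndef S) = c.μ := by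
  rw [c.relIndef_eq, finrank_span_eq_card (c.bW.linearIndependent.comp _ Sum.inl_injective),
    Fintype.card_fin]

theorem μ_eq_α (h : finrank ℂ S = finrank ℂ V) : c.μ = c.α := by
  have h1 : finrank ℂ S = c.μ + (c.β + c.γ) := by
    conv_lhs => rw [c.eq_span_range_gen]
    rw [finrank_span_eq_card (linearIndependent_prod_of_forall
      (fun a => c.sum_smul_genV) fun a => c.sum_smul_genW)]
    simp
  have h2 : finrank ℂ V = c.α + (c.β + c.γ) := by
    rw [finrank_eq_card_basis c.bV]
    simp
  omega

end CanonicalBasisPair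

/-- The operator `λ^m(S)` is the degree-`m` component of a monomial operator. -/
theorem IsLambdaM.exists_isMonomialOp {S : Submodule ℂ (V × W)} (c : CanonicalBasisPair S) {m : ℕ}
    {L : (⋀[ℂ]^m V) →ₗ[ℂ] (⋀[ℂ]^m W)} (hL : IsLambdaM c m L) (hμ : c.μ = c.α) :
    ∃ (B : Fin c.α ⊕ Fin c.β ⊕ Fin c.γ → W)
      (T : ExteriorAlgebra ℂ V →ₗ[ℂ] ExteriorAlgebra ℂ W),
      IsMonomialOp c.bV B (Set.range Sum.inl) T ∧ (∀ z, (L z : ExteriorAlgebra ℂ W) = T z) ∧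
      (∀ l ∈ Set.range Sum.inl, B l ∈ relIndef S) ∧
      S ≤ Submodule.span ℂ ((fun l => ((0 : V), B l)) '' Set.range Sum.inl ∪
        (fun l => (c.bV l, B l)) '' (Set.range Sum.inl)ᶜ) := by
  obtain ⟨α, β, γ, μ, ν, bV, bW, hspan⟩ := c
  dsimp at hμ ⊢
  subst hμ
  obtain ⟨B, hB⟩ : ∃ B : Fin μ ⊕ Fin β ⊕ Fin γ → W,
    B = Sum.elim (bW ∘ Sum.inl) (Sum.elim (bW ∘ Sum.inr ∘ Sum.inl) 0) := ⟨_, rfl⟩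
  obtain ⟨T, hT⟩ := _root_.exists_isMonomialOp bV B (Set.range Sum.inl)
  refine ⟨B, T, hT, ?_, ?_, ?_⟩
  · have h : (⋀[ℂ]^m W).subtype ∘ₗ L = T ∘ₗ (⋀[ℂ]^m V).subtype := by
      refine linearMap_ext_monomial bV fun x hx => ?_
      change (L (ιMultiP m (bV ∘ x)) : ExteriorAlgebra ℂ W) =
        T (ExteriorAlgebra.ιMulti ℂ m (bV ∘ x))
      by_cases hlo : Set.range Sum.inl ⊆ Set.range x
      · rw [hT.apply_of_subset m x hlo]
        by_cases hhi : ∃ l, Sum.inr (Sum.inr l) ∈ Set.range x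
        · refine (congrArg Subtype.val (hL.2 x (Or.inr hhi))).trans ?_
          obtain ⟨l, p, hp⟩ := hhi
          exact (AlternatingMap.map_coord_zero _ p (by simp [hB, hp])).symm
        · obtain ⟨s, hs⟩ : ∃ s : Finset (Fin β), ∀ j, j ∈ s ↔ Sum.inr (Sum.inl j) ∈ Set.range x := by
            classical
            exact ⟨Finset.univ.filter fun j => Sum.inr (Sum.inl j) ∈ Set.range x, by simp⟩
          obtain ⟨y, hy⟩ : ∃ y : Fin (μ + s.card) → Fin μ ⊕ Fin β ⊕ Fin γ,
            y = Sum.elim Sum.inl (fun j => Sum.inr (Sum.inl (s.orderIsoOfFin rfl j : Fin β))) ∘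
              finSumFinEquiv.symm := ⟨_, rfl⟩
          have hyinj : Function.Injective y := by
            rw [hy]
            refine (Sum.inl_injective.sumElim ?_ (by simp)).comp finSumFinEquiv.symm.injective
            exact Sum.inr_injective.comp (Sum.inl_injective.comp
              (Subtype.val_injective.comp (s.orderIsoOfFin rfl).injective))
          have hyrange : Set.range x = Set.range y := by
            rw [hy, EquivLike.range_comp, Set.Sum.elim_range]
            ext (l | j | l)
            · simpa using hlo ⟨l, rfl⟩
            · have hj : (∃ p, (s.orderIsoOfFin rfl p : Fin β) = j) ↔ j ∈ s :=
                ⟨fun ⟨p, hp⟩ => hp ▸ (s.orderIsoOfFin rfl p).2, fun h =>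
                  ⟨(s.orderIsoOfFin rfl).symm ⟨j, h⟩, by simp⟩⟩
              rw [← hs, ← hj]
              simp
            · simpa using fun p hp => hhi ⟨l, p, hp⟩
          have hm : μ + s.card = m := by
            have h := congrArg Set.ncard hyrange
            rw [← Set.image_univ, ← Set.image_univ, Set.ncard_image_of_injective _ hx,
              Set.ncard_image_of_injective _ hyinj] at h
            simpa using h.symm
          have key := congrArg Subtype.val (hL.1 s hm hm)
          subst hm
          have hV : goodTupleV ⟨μ, β, γ, μ, ν, bV, bW, hspan⟩ s = bV ∘ y := by
            rw [hy]
            ext p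
            refine Fin.addCases (fun p => ?_) (fun p => ?_) p <;> simp [goodTupleV]
          have hW : goodTupleW ⟨μ, β, γ, μ, ν, bV, bW, hspan⟩ s = B ∘ y := by
            rw [hy, hB]
            ext p
            refine Fin.addCases (fun p => ?_) (fun p => ?_) p <;> simp [goodTupleW]
          rw [hV, hW] at key
          obtain ⟨τ, rfl⟩ := exists_perm_of_range_eq hx hyrange
          have hperm : ιMultiP (μ + s.card) (bV ∘ (y ∘ τ)) =
              Equiv.Perm.sign τ • ιMultiP (μ + s.card) (bV ∘ y) :=
            Subtype.ext (AlternatingMap.map_perm _ (bV ∘ y) τ)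
          rw [hperm, ← Function.comp_assoc, AlternatingMap.map_perm, Units.smul_def,
            Units.smul_def, map_zsmul]
          exact congrArg _ key
      · rw [hT.apply_of_not_subset m x hlo]
        refine congrArg Subtype.val (hL.2 x (Or.inl ?_))
        obtain ⟨_, ⟨l, rfl⟩, hl⟩ := Set.not_subset.1 hlo
        exact ⟨l, hl⟩
    exact DFunLike.congr_fun h
  · rintro _ ⟨l, rfl⟩
    rw [hspan]
    exact mem_relIndef.2 (Submodule.subset_span (Or.inl (Or.inl ⟨l, by simp [hB]⟩)))
  · conv_lhs => rw [hspan]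
    refine Submodule.span_mono ?_
    rintro _ ((⟨l, rfl⟩ | ⟨l, rfl⟩) | ⟨l, rfl⟩)
    · exact Or.inl ⟨_, ⟨l, rfl⟩, by simp [hB]⟩
    · exact Or.inr ⟨Sum.inr (Sum.inl l), by simp, by simp [hB]⟩
    · exact Or.inr ⟨Sum.inr (Sum.inr l), by simp, by simp [hB]⟩

end GeneratingFamilies

section HingeDegeneration

variable {V : Type*} [AddCommGroup V] [Module ℂ V] {ι : Type} {k : ℕ}
  {P : Fin k → Submodule ℂ (V × V)} {e E : Basis ι ℂ V} {w : ι → Fin k}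

theorem IsHinge.relIndef_eq_span [FiniteDimensional ℂ V] [Finite ι] (hP : IsHinge P)
    (hw : ∀ l, (e l, E l) ∈ P (w l)) (i : Fin k) :
    relIndef (P i) = Submodule.span ℂ (E '' {l | w l < i}) := by
  classical
  have := Fintype.ofFinite ι
  obtain ⟨b, hb⟩ : ∃ b : ι → V, ∀ l, b l = if w l < i then 0 else e l := ⟨_, fun _ => rfl⟩
  obtain ⟨B, hB⟩ : ∃ B : ι → V, ∀ l, B l = if i < w l then 0 else E l := ⟨_, fun _ => rfl⟩
  have hbli : ∀ c : ι → ℂ, ∑ l, c l • b l = 0 → ∀ l ∉ {l | w l < i}, c l = 0 := by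
    intro c hc l hl
    have := Fintype.linearIndependent_iff.1 e.linearIndependent
      (fun l => if w l < i then 0 else c l) (by simpa [hb, ite_smul, smul_ite] using hc) l
    rwa [if_neg (show ¬ w l < i from hl)] at this
  have hBli : ∀ c : ι → ℂ, ∑ l, c l • B l = 0 → ∀ l ∈ {l | w l < i}, c l = 0 := by
    intro c hc l hl
    have := Fintype.linearIndependent_iff.1 E.linearIndependent
      (fun l => if i < w l then 0 else c l) (by simpa [hB, ite_smul, smul_ite] using hc) l
    rwa [if_neg (not_lt.2 (le_of_lt hl))] at this
  have hspan : Submodule.span ℂ (Set.range fun l => (b l, B l)) = P i := by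
    refine Submodule.eq_of_le_of_finrank_eq (Submodule.span_le.2 ?_) ?_
    · rintro _ ⟨l, rfl⟩
      rcases lt_trichotomy (w l) i with h | h | h
      · simpa [hb, hB, h, h.not_gt] using hP.mem_of_gt h (hw l)
      · simpa [hb, hB, h] using h ▸ hw l
      · simpa [hb, hB, h, h.not_gt] using hP.mem_of_lt h (hw l)
    · rw [finrank_span_eq_card (linearIndependent_prod_of_forall hbli hBli), hP.dim_eq,
        finrank_eq_card_basis e]
  rw [← hspan, relIndef_span_range (fun l hl => (hb l).trans (if_pos hl)) hbli]
  congr 1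
  exact Set.image_congr fun l hl => (hB l).trans (if_neg (not_lt.2 (le_of_lt hl)))

/-- In a pair of bases adapted to a hinge, `λ^m` is a multiple of a monomial operator. -/
theorem IsLambdaChoice.exists_isMonomialOp [FiniteDimensional ℂ V] [Finite ι] (hP : IsHinge P)
    (hw : ∀ l, (e l, E l) ∈ P (w l)) {m : ℕ} {L : (⋀[ℂ]^m V) →ₗ[ℂ] (⋀[ℂ]^m V)}
    (hL : IsLambdaChoice P m L) :
    ∃ (i : Fin k) (T : ExteriorAlgebra ℂ V →ₗ[ℂ] ExteriorAlgebra ℂ V) (a : ℂ),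
      IsMonomialOp e (fun l => if i < w l then 0 else E l) {l | w l < i} T ∧
      (∀ z, (L z : ExteriorAlgebra ℂ V) = a • T z) ∧ L ≠ 0 := by
  obtain ⟨i, c, hLc, hL0⟩ := hL
  have hα := c.μ_eq_α (hP.dim_eq i)
  obtain ⟨B, T, hT, hLT, hB, hS⟩ := hLc.exists_isMonomialOp c hα
  obtain ⟨T', hT'⟩ :=
    _root_.exists_isMonomialOp e (fun l => if i < w l then 0 else E l) {l | w l < i}
  have hlo : (fun l => if i < w l then 0 else E l) '' {l | w l < i} = E '' {l | w l < i} :=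
    Set.image_congr fun l hl => if_neg (not_lt.2 (le_of_lt hl))
  obtain ⟨a, rfl⟩ : ∃ a : ℂ, T = a • T' := by
    refine hT.exists_eq_smul hT' ?_ (fun l hl => ?_) fun l hl => hS ?_
    · have := Fintype.ofFinite {l | w l < i}
      have h1 : finrank ℂ (relIndef (P i)) = {l | w l < i}.ncard := by
        have hli : LinearIndependent ℂ fun l : {l | w l < i} => E l :=
          E.linearIndependent.comp _ Subtype.val_injective
        rw [hP.relIndef_eq_span hw, Set.image_eq_range, finrank_span_eq_card hli,
          ← Nat.card_eq_fintype_card, Nat.card_coe_set_eq]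
      rw [← h1, c.finrank_relIndef, hα, ← Set.image_univ,
        Set.ncard_image_of_injective _ Sum.inl_injective]
      simp
    · rw [hlo, ← hP.relIndef_eq_span hw]
      exact hB l hl
    · rcases (not_lt.1 hl : i ≤ w l).eq_or_lt with h | h
      · simpa [← h] using h ▸ hw l
      · simpa [h] using hP.mem_of_lt h (hw l)
  exact ⟨i, T', a, hT', hLT, hL0⟩

theorem sum_weight_le_of_card_eq [Finite ι] (w : ι → ℕ) (i : ℕ) {s t : Finset ι}
    (hcard : s.card = t.card) (hlo : ∀ l, w l < i → l ∈ s) (hhi : ∀ l ∈ s, w l ≤ i) :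
    ∑ l ∈ s, w l ≤ ∑ l ∈ t, w l ∧
      (∑ l ∈ t, w l ≤ ∑ l ∈ s, w l → (∀ l, w l < i → l ∈ t) ∧ ∀ l ∈ t, w l ≤ i) := by
  classical
  have := Fintype.ofFinite ι
  have hsum : ∀ u : Finset ι, ∑ l, (if l ∈ u then (w l : ℤ) - i else 0) =
      (∑ l ∈ u, w l : ℕ) - u.card * i := fun u => by
    rw [← Finset.sum_filter, Finset.filter_mem_eq_inter, Finset.univ_inter]
    simp [Finset.sum_sub_distrib]
  have hle : ∀ l, (if l ∈ s then (w l : ℤ) - i else 0) ≤ if l ∈ t then (w l : ℤ) - i else 0 := by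
    intro l
    have h1 := hlo l
    have h2 := hhi l
    split_ifs with h3 h4 h4
    · exact le_rfl
    · have := h2 h3
      omega
    · have : ¬ w l < i := fun h => h3 (h1 h)
      omega
    · exact le_rfl
  have h1 := Finset.sum_le_sum fun l (_ : l ∈ Finset.univ) => hle l
  rw [hsum, hsum, hcard] at h1
  refine ⟨by omega, fun h => ?_⟩
  have h2 := (Finset.sum_eq_sum_iff_of_le fun l (_ : l ∈ Finset.univ) => hle l).1
    (by rw [hsum, hsum, hcard]; omega)
  refine ⟨fun l hl => ?_, fun l hl => ?_⟩
  · have h3 := h2 l (Finset.mem_univ l)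
    by_contra h4
    rw [if_pos (hlo l hl), if_neg h4] at h3
    omega
  · have h3 := h2 l (Finset.mem_univ l)
    by_contra h4
    rw [if_neg fun h5 => h4 (hhi l h5), if_pos hl] at h3
    omega

/-- A nonzero multiple of the monomial operator attached to a weight function is the value at `0`
of a polynomial family which, up to scalars, consists of exterior powers of weighted base
changes. -/
theorem exists_isPolyFamily_of_isMonomialOp [Finite ι] (e E : Basis ι ℂ V) (w : ι → ℕ) (i : ℕ)
    {T : ExteriorAlgebra ℂ V →ₗ[ℂ] ExteriorAlgebra ℂ V}
    (hT : IsMonomialOp e (fun l => if i < w l then 0 else E l) {l | w l < i} T) {m : ℕ}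
    {L : (⋀[ℂ]^m V) →ₗ[ℂ] (⋀[ℂ]^m V)} {a : ℂ}
    (hLT : ∀ z, (L z : ExteriorAlgebra ℂ V) = a • T z) (hL : L ≠ 0) :
    ∃ F : ℂ → (⋀[ℂ]^m V) →ₗ[ℂ] (⋀[ℂ]^m V), IsPolyFamily F ∧ F 0 = L ∧
      ∀ s, s ≠ 0 → ∃ c : ℂ, F s = c • exteriorPowerMap m (e.constr ℂ fun l => s ^ w l • E l) := by
  classical
  have := Fintype.ofFinite ι
  have hbad : ∀ x : Fin m → ι, ¬ ((∀ l, w l < i → l ∈ Finset.univ.image x) ∧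
      ∀ l ∈ Finset.univ.image x, w l ≤ i) → L (ιMultiP m (e ∘ x)) = 0 := by
    intro x hx
    refine Subtype.ext ((hLT _).trans ?_)
    change a • T (ExteriorAlgebra.ιMulti ℂ m (e ∘ x)) = 0
    by_cases hlo : {l | w l < i} ⊆ Set.range x
    · obtain ⟨p, hp⟩ : ∃ p, i < w (x p) := by
        by_contra! h
        exact hx ⟨fun l hl => by simpa using hlo hl, by simpa using h⟩
      rw [hT.apply_of_subset m x hlo, AlternatingMap.map_coord_zero _ p (by simp [hp]), smul_zero]
    · rw [hT.apply_of_not_subset m x hlo, smul_zero]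
  have hgood : ∀ x : Fin m → ι, ((∀ l, w l < i → l ∈ Finset.univ.image x) ∧
      ∀ l ∈ Finset.univ.image x, w l ≤ i) → L (ιMultiP m (e ∘ x)) = a • ιMultiP m (E ∘ x) := by
    intro x hx
    refine Subtype.ext ((hLT _).trans ?_)
    change a • T (ExteriorAlgebra.ιMulti ℂ m (e ∘ x)) = a • ExteriorAlgebra.ιMulti ℂ m (E ∘ x)
    rw [hT.apply_of_subset m x fun l hl => by simpa using hx.1 l hl]
    congr 2
    ext p
    exact if_neg (not_lt.2 (hx.2 _ (by simp)))
  obtain ⟨x₀, hx₀, hlo, hhi⟩ : ∃ x₀ : Fin m → ι, Function.Injective x₀ ∧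
      (∀ l, w l < i → l ∈ Finset.univ.image x₀) ∧ ∀ l ∈ Finset.univ.image x₀, w l ≤ i := by
    by_contra! h
    refine hL (linearMap_ext_monomial e fun x hx => hbad x ?_)
    rintro ⟨h1, h2⟩
    obtain ⟨l, hl, hl'⟩ := h x hx h1
    exact hl'.not_ge (h2 l hl)
  obtain ⟨d, hd⟩ : ∃ d, d = ∑ l ∈ Finset.univ.image x₀, w l := ⟨_, rfl⟩
  have hcard : ∀ x : Fin m → ι, Function.Injective x →
      (Finset.univ.image x₀).card = (Finset.univ.image x).card := fun x hx => by
    rw [Finset.card_image_of_injective _ hx, Finset.card_image_of_injective _ hx₀]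
  have hM : ∀ s : Finset ι, ∃ M : (⋀[ℂ]^m V) →ₗ[ℂ] (⋀[ℂ]^m V), ∀ x : Fin m → ι,
      Function.Injective x → M (ιMultiP m (e ∘ x)) =
        (if Finset.univ.image x = s then (1 : ℂ) else 0) • ιMultiP m (E ∘ x) := by
    intro s
    obtain ⟨T, hT⟩ := exists_monomial_operator e E fun t => if t = (s : Set ι) then 1 else 0
    obtain ⟨M, hM⟩ := exists_monomial_operator_degree e E m T _ (hT m)
    refine ⟨M, fun x hx => Subtype.ext ((hM _).trans ((hT m x hx).trans ?_))⟩
    have : (Set.range x = (s : Set ι)) ↔ Finset.univ.image x = s := by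
      rw [← Finset.coe_inj]
      simp
    simp only [this]
    rfl
  choose M hM using hM
  have hsum : ∀ (z : ℂ) (x : Fin m → ι), Function.Injective x →
      (∑ s : Finset ι, z ^ (∑ l ∈ s, w l - d) • a • M s) (ιMultiP m (e ∘ x)) =
        z ^ (∑ p, w (x p) - d) • a • ιMultiP m (E ∘ x) := by
    intro z x hx
    rw [LinearMap.sum_apply, Finset.sum_eq_single (Finset.univ.image x)]
    · simp [hM _ x hx, Finset.sum_image fun p _ q _ h => hx h]
    · intro s _ hs
      simp [hM _ x hx, hs.symm]
    · simp
  have hW : ∀ x : Fin m → ι, Function.Injective x →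
      ∑ l ∈ Finset.univ.image x, w l = ∑ p, w (x p) := fun x hx =>
    Finset.sum_image fun p _ q _ h => hx h
  refine ⟨fun z => ∑ s : Finset ι, z ^ (∑ l ∈ s, w l - d) • a • M s,
    ⟨Finset ι, inferInstance, fun s => ∑ l ∈ s, w l - d, fun s => a • M s, fun _ => rfl⟩, ?_, ?_⟩
  · refine linearMap_ext_monomial e fun x hx => ?_
    rw [hsum 0 x hx, ← hW x hx]
    obtain ⟨h1, h2⟩ := sum_weight_le_of_card_eq w i (hcard x hx) hlo hhi
    rw [← hd] at h1 h2
    by_cases hx' : (∀ l, w l < i → l ∈ Finset.univ.image x) ∧ ∀ l ∈ Finset.univ.image x, w l ≤ i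
    · have h3 := (sum_weight_le_of_card_eq w i (hcard x hx).symm hx'.1 hx'.2).1
      rw [← hd] at h3
      rw [hgood x hx', Nat.sub_eq_zero_of_le h3, pow_zero, one_smul]
    · rw [hbad x hx', zero_pow, zero_smul]
      intro h3
      exact hx' (h2 (by omega))
  · intro z hz
    refine ⟨a * (z ^ d)⁻¹, linearMap_ext_monomial e fun x hx => ?_⟩
    have h1 := (sum_weight_le_of_card_eq w i (hcard x hx) hlo hhi).1
    rw [← hd, hW x hx] at h1
    rw [hsum z x hx, LinearMap.smul_apply, exteriorPowerMap_ιMultiP]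
    have h2 : ιMultiP m ((e.constr ℂ fun l => z ^ w l • E l) ∘ (e ∘ x)) =
        z ^ (∑ p, w (x p)) • ιMultiP m (E ∘ x) := by
      have h3 : (e.constr ℂ fun l => z ^ w l • E l) ∘ (e ∘ x) =
          fun p => z ^ w (x p) • (E ∘ x) p := by
        ext p
        simp
      rw [h3, ← Finset.prod_pow_eq_pow_sum]
      exact Subtype.ext (MultilinearMap.map_smul_univ
        (ExteriorAlgebra.ιMulti ℂ m).toMultilinearMap (fun p => z ^ w (x p)) (E ∘ x))
    rw [h2, smul_smul, smul_smul, pow_sub₀ z hz h1]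
    congr 1
    ring

/-- The operators attached to a hinge are, up to scalars, a simultaneous limit of exterior powers
of invertible operators. -/
theorem IsHinge.exists_isPolyFamily [FiniteDimensional ℂ V] (hP : IsHinge P) {δ : Type*}
    (m : δ → ℕ) {L : ∀ d, (⋀[ℂ]^(m d) V) →ₗ[ℂ] (⋀[ℂ]^(m d) V)}
    (hL : ∀ d, IsLambdaChoice P (m d) (L d)) :
    ∃ F : ∀ d, ℂ → (⋀[ℂ]^(m d) V) →ₗ[ℂ] (⋀[ℂ]^(m d) V), (∀ d, IsPolyFamily (F d)) ∧
      (fun d => F d 0) = L ∧ ∀ s, s ≠ 0 → ∃ (g : V ≃ₗ[ℂ] V) (a : δ → ℂ),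
        ∀ d, F d s = a d • exteriorPowerMap (m d) (g : V →ₗ[ℂ] V) := by
  obtain ⟨ι, _, e, E, w, hw⟩ := hP.exists_adapted_bases
  have hF : ∀ d, ∃ F : ℂ → (⋀[ℂ]^(m d) V) →ₗ[ℂ] (⋀[ℂ]^(m d) V),
      IsPolyFamily F ∧ F 0 = L d ∧ ∀ s, s ≠ 0 → ∃ c : ℂ,
        F s = c • exteriorPowerMap (m d) (e.constr ℂ fun l => s ^ (w l : ℕ) • E l) := by
    intro d
    obtain ⟨i, T, a, hT, hLT, hL0⟩ := (hL d).exists_isMonomialOp hP hw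
    exact exists_isPolyFamily_of_isMonomialOp e E (fun l => (w l : ℕ)) i hT hLT hL0
  choose F hF hF0 hFs using hF
  refine ⟨F, hF, funext hF0, fun s hs => ?_⟩
  choose c hc using fun d => hFs d s hs
  refine ⟨e.equiv (E.unitsSMul fun l => Units.mk0 (s ^ (w l : ℕ)) (pow_ne_zero _ hs))
    (Equiv.refl ι), c, fun d => (hc d).trans ?_⟩
  congr 2
  refine e.ext fun l => ?_
  simp [Basis.unitsSMul_apply, Units.smul_def]

end HingeDegeneration

theorem hinge_operator_maps_HNu_into_itself
    (n : ℕ) (ν : ℕ → ℕ) (hν : ∀ i, ν (i + 1) ≤ ν i) (hν' : ν (n + 1) = 0)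
    {k : ℕ} (P : Fin k → Submodule ℂ ((Fin n → ℂ) × (Fin n → ℂ))) (hP : IsHinge P)
    (L : ∀ d : Fin n, (⋀[ℂ]^(d.1 + 1) (Fin n → ℂ)) →ₗ[ℂ] (⋀[ℂ]^(d.1 + 1) (Fin n → ℂ)))
    (hL : ∀ d : Fin n, IsLambdaChoice P (d.1 + 1) (L d)) :
    ∀ x ∈ HNu n ν, bigTensorOp n ν L x ∈ HNu n ν := by
  obtain ⟨F, hF, rfl, hg⟩ := hP.exists_isPolyFamily (fun d : Fin n => d.1 + 1) hL
  exact fun x hx => bigTensorOp_mem_HNu_of_family n ν hF hg hx
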